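/- Coordinatewise exponential-average ratio bound (inequalities (A.13)–(A.14) in the proof of Lemma A.2). Let t ≥ 1, G > 0, and let g_1,…,g_t be real numbers with |g_j| ≤ G for all j and g_1 ≠ 0 (so the denominator below is positive). Let β_1 ∈ [0,1), β_2 ∈ (0,1), p ∈ [0,1/2], q ∈ [max{4p−1, 0}, 1], and γ := β_1/β_2^{2p}. Then (∑_{j=1}^t (1−β_1) β_1^{t−j} g_j)^2 / (∑_{j=1}^t (1−β_2) β_2^{t−j} g_j^2)^{2p} ≤ ((1−β_1) G^{1+q−4p} / (1−β_2)^{2p}) · ∑_{j=1}^t γ^{t−j} |g_j|^{1−q}. -/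

import Mathlib

open Finset Real

lemma weights_sum (β : ℝ) (t : ℕ) :
    ∑ j ∈ Finset.Icc 1 t, (1 - β) * β ^ (t - j) = 1 - β ^ t := by
  induction t with
  | zero => simp
  | succ n ih =>
    rw [Finset.sum_Icc_succ_top (by omega)]
    have h : ∑ j ∈ Finset.Icc 1 n, (1 - β) * β ^ (n + 1 - j)
        = β * ∑ j ∈ Finset.Icc 1 n, (1 - β) * β ^ (n - j) := by
      rw [Finset.mul_sum]
      refine Finset.sum_congr rfl fun j hj => ?_
      rw [Nat.sub_add_comm (Finset.mem_Icc.1 hj).2, pow_succ]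
      ring
    rw [h, ih, Nat.sub_self]
    ring

lemma term_bound (k : ℕ) (G β1 β2 p q x V : ℝ) (hG : 0 < G) (hx : |x| ≤ G)
    (hβ1 : 0 ≤ β1) (hβ2 : 0 < β2) (hβ2lt : β2 < 1) (hp0 : 0 ≤ p)
    (hq : 4 * p - 1 ≤ q) (hV : 0 < V) (hVx : (1 - β2) * β2 ^ k * x ^ 2 ≤ V) :
    β1 ^ k * x ^ 2 ≤ (G ^ (1 + q - 4 * p) / (1 - β2) ^ (2 * p)
      * ((β1 / β2 ^ (2 * p)) ^ k * |x| ^ (1 - q))) * V ^ (2 * p) := by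
  have h1 : 0 < 1 - β2 := by linarith
  rcases eq_or_ne x 0 with rfl | hx0
  · have : (0:ℝ) ≤ |(0:ℝ)| ^ (1 - q) := by positivity
    have : 0 ≤ (G ^ (1 + q - 4 * p) / (1 - β2) ^ (2 * p)
      * ((β1 / β2 ^ (2 * p)) ^ k * |(0:ℝ)| ^ (1 - q))) * V ^ (2 * p) := by positivity
    simpa using this
  have ha : 0 < |x| := abs_pos.2 hx0
  have hA : 0 < (1 - β2) ^ (2 * p) := by positivity
  have hB : 0 < (β2 ^ (2 * p)) ^ k := by positivity
  have hVp : (1 - β2) ^ (2 * p) * (β2 ^ (2 * p)) ^ k * |x| ^ (4 * p) ≤ V ^ (2 * p) := by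
    refine le_trans (le_of_eq ?_)
      (Real.rpow_le_rpow (by positivity) hVx (by linarith : 0 ≤ 2 * p))
    rw [Real.mul_rpow (by positivity) (by positivity), Real.mul_rpow h1.le (by positivity)]
    congr 1
    · congr 1
      rw [← Real.rpow_natCast, ← Real.rpow_natCast, ← Real.rpow_mul hβ2.le,
        ← Real.rpow_mul hβ2.le, mul_comm]
    · rw [← sq_abs, ← Real.rpow_natCast, ← Real.rpow_mul ha.le]
      congr 1
      push_cast
      ring
  have hGx : |x| ^ (1 + q - 4 * p) ≤ G ^ (1 + q - 4 * p) :=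
    Real.rpow_le_rpow ha.le hx (by linarith)
  have hxx : x ^ 2 = |x| ^ (1 + q - 4 * p) * |x| ^ (1 - q) * |x| ^ (4 * p) := by
    rw [← Real.rpow_add ha, ← Real.rpow_add ha, ← sq_abs, ← Real.rpow_natCast]
    congr 1
    push_cast
    ring
  calc β1 ^ k * x ^ 2
      ≤ β1 ^ k * (G ^ (1 + q - 4 * p) * |x| ^ (1 - q) * |x| ^ (4 * p)) := by
        rw [hxx]; gcongr
    _ = (G ^ (1 + q - 4 * p) / (1 - β2) ^ (2 * p)
      * ((β1 / β2 ^ (2 * p)) ^ k * |x| ^ (1 - q)))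
      * ((1 - β2) ^ (2 * p) * (β2 ^ (2 * p)) ^ k * |x| ^ (4 * p)) := by
        rw [div_pow]
        field_simp
    _ ≤ _ := by gcongr

/-- **Coordinatewise exponential-average ratio bound (inequalities (A.13)–(A.14)).** For
`t ≥ 1`, `|gⱼ| ≤ G` for `1 ≤ j ≤ t`, `g₁ ≠ 0`, `β₁ ∈ [0,1)`, `β₂ ∈ (0,1)`, `p ∈ [0,1/2]`,
`q ∈ [max{4p-1,0},1]` and `γ = β₁/β₂^{2p}`:
`(∑ⱼ (1-β₁) β₁^{t-j} gⱼ)² / (∑ⱼ (1-β₂) β₂^{t-j} gⱼ²)^{2p}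
≤ ((1-β₁) G^{1+q-4p} / (1-β₂)^{2p}) ∑ⱼ γ^{t-j} |gⱼ|^{1-q}`. -/
theorem exp_avg_ratio_bound (t : ℕ) (G β1 β2 p q : ℝ) (g : ℕ → ℝ)
    (ht : 1 ≤ t) (hG : 0 < G)
    (hg : ∀ j, 1 ≤ j → j ≤ t → |g j| ≤ G) (hg1 : g 1 ≠ 0)
    (hβ1 : 0 ≤ β1) (hβ1lt : β1 < 1) (hβ2 : 0 < β2) (hβ2lt : β2 < 1)
    (hp0 : 0 ≤ p) (hp2 : p ≤ 1 / 2)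
    (hq0 : max (4 * p - 1) 0 ≤ q) (hq1 : q ≤ 1) :
    (∑ j ∈ Finset.Icc 1 t, (1 - β1) * β1 ^ (t - j) * g j) ^ 2
        / (∑ j ∈ Finset.Icc 1 t, (1 - β2) * β2 ^ (t - j) * (g j) ^ 2) ^ (2 * p)
      ≤ ((1 - β1) * G ^ (1 + q - 4 * p) / (1 - β2) ^ (2 * p))
        * ∑ j ∈ Finset.Icc 1 t, (β1 / β2 ^ (2 * p)) ^ (t - j) * |g j| ^ (1 - q) := by
  have h1 : 0 < 1 - β1 := by linarith
  have h2 : 0 < 1 - β2 := by linarith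
  have hterm : ∀ j ∈ Finset.Icc 1 t, 0 ≤ (1 - β2) * β2 ^ (t - j) * (g j) ^ 2 :=
    fun j _ => by positivity
  have hle : ∀ j ∈ Finset.Icc 1 t, (1 - β2) * β2 ^ (t - j) * (g j) ^ 2
      ≤ ∑ j ∈ Finset.Icc 1 t, (1 - β2) * β2 ^ (t - j) * (g j) ^ 2 :=
    fun j hj => Finset.single_le_sum
      (f := fun j => (1 - β2) * β2 ^ (t - j) * (g j) ^ 2) hterm hj
  have hV : 0 < ∑ j ∈ Finset.Icc 1 t, (1 - β2) * β2 ^ (t - j) * (g j) ^ 2 :=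
    lt_of_lt_of_le (by positivity) (hle 1 (Finset.mem_Icc.2 ⟨le_rfl, ht⟩))
  set V := ∑ j ∈ Finset.Icc 1 t, (1 - β2) * β2 ^ (t - j) * (g j) ^ 2
  have hCS : (∑ j ∈ Finset.Icc 1 t, (1 - β1) * β1 ^ (t - j) * g j) ^ 2
      ≤ (∑ j ∈ Finset.Icc 1 t, (1 - β1) * β1 ^ (t - j))
        * ∑ j ∈ Finset.Icc 1 t, (1 - β1) * β1 ^ (t - j) * (g j) ^ 2 :=
    Finset.sum_sq_le_sum_mul_sum_of_sq_eq_mul _ (fun j _ => by positivity)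
      (fun j _ => by positivity) (fun j _ => by ring)
  have hS : 0 ≤ ∑ j ∈ Finset.Icc 1 t, (1 - β1) * β1 ^ (t - j) * (g j) ^ 2 :=
    Finset.sum_nonneg fun j _ => by positivity
  have hW : 1 - β1 ^ t ≤ 1 := by linarith [pow_nonneg hβ1 t]
  rw [weights_sum] at hCS
  rw [div_le_iff₀ (by positivity)]
  refine (hCS.trans (mul_le_of_le_one_left hS hW)).trans ?_
  rw [Finset.mul_sum, Finset.sum_mul]
  refine Finset.sum_le_sum fun j hj => ?_
  have hj' := Finset.mem_Icc.1 hj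
  have := term_bound (t - j) G β1 β2 p q (g j) V hG (hg j hj'.1 hj'.2) hβ1 hβ2 hβ2lt hp0
    ((le_max_left _ _).trans hq0) hV (hle j hj)
  calc (1 - β1) * β1 ^ (t - j) * (g j) ^ 2 = (1 - β1) * (β1 ^ (t - j) * (g j) ^ 2) := by ring
    _ ≤ _ := mul_le_mul_of_nonneg_left this h1.le
    _ = _ := by ring
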